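/- Let d be an odd integer with d ≥ 3, let S = {a ∈ ℕ : 0 < a < 2^d−1 and s(a) + s(5a) = s(6a) + 1}, and let J ⊆ S be a complete set of cyclotomic coset representatives of S, i.e., for every a ∈ S there exist a unique b ∈ J and a unique i with 0 ≤ i < d such that a ≡ 2^i·b (mod 2^d−1). Then for every β ∈ F_{2^d}^*, the equation x^6 + x + β = 0 has exactly two distinct solutions in F_{2^d} if and only if Tr(∑_{a ∈ J} β^{5a}) = 0, where Tr is the trace from F_{2^d} to F₂. -/

import Mathlib

/-- `sBin d x` is the number of 1's in the binary representation of the reduction of `x`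
modulo `2^d - 1`. -/
def sBin (d x : ℕ) : ℕ := (Nat.digits 2 (x % (2 ^ d - 1))).count 1

/-- binary digit sum -/
def pcount (n : ℕ) : ℕ := (Nat.digits 2 n).sum

lemma pcount_zero : pcount 0 = 0 := by simp [pcount]

lemma pcount_two_mul (n : ℕ) : pcount (2 * n) = pcount n := by
  rcases Nat.eq_zero_or_pos n with rfl | h
  · simp
  · unfold pcount
    rw [Nat.digits_def' (by norm_num) (by omega)]
    simp

lemma pcount_two_mul_add_one (n : ℕ) : pcount (2 * n + 1) = pcount n + 1 := by
  unfold pcount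
  rw [Nat.digits_def' (by norm_num) (by omega)]
  have h1 : (2 * n + 1) % 2 = 1 := by omega
  have h2 : (2 * n + 1) / 2 = n := by omega
  rw [h1, h2]
  simp [add_comm]

lemma count_one_eq_sum (l : List ℕ) (h : ∀ x ∈ l, x < 2) : l.count 1 = l.sum := by
  induction l with
  | nil => simp
  | cons a l ih =>
    have ha : a < 2 := h a (by simp)
    have := ih (fun x hx => h x (by simp [hx]))
    rw [List.count_cons, List.sum_cons, this]
    interval_cases a <;> simp [add_comm]

lemma sBin_eq (d x : ℕ) : sBin d x = pcount (x % (2 ^ d - 1)) := by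
  unfold sBin pcount
  exact count_one_eq_sum _ (fun x hx => Nat.digits_lt_base (by norm_num) hx)

lemma pcount_top (e y : ℕ) (h : y < 2 ^ e) : pcount (2 ^ e + y) = pcount y + 1 := by
  induction e generalizing y with
  | zero =>
    have : y = 0 := by simpa using h
    subst this
    have := pcount_two_mul_add_one 0
    simpa using this
  | succ e ih =>
    obtain ⟨z, rfl | rfl⟩ := Nat.even_or_odd' y
    · have := ih z (by omega)
      rw [show 2 ^ (e + 1) + 2 * z = 2 * (2 ^ e + z) by ring, pcount_two_mul, pcount_two_mul, this]
    · have := ih z (by omega)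
      rw [show 2 ^ (e + 1) + (2 * z + 1) = 2 * (2 ^ e + z) + 1 by ring, pcount_two_mul_add_one,
        pcount_two_mul_add_one, this]

lemma pcount_compl (e x y : ℕ) (h : x + y + 1 = 2 ^ e) : pcount x + pcount y = e := by
  induction e generalizing x y with
  | zero =>
    have hx : x = 0 := by simp at h; omega
    have hy : y = 0 := by simp at h; omega
    subst hx hy
    simp [pcount_zero]
  | succ e ih =>
    rw [pow_succ] at h
    obtain ⟨z, rfl | rfl⟩ := Nat.even_or_odd' x <;> obtain ⟨w, rfl | rfl⟩ := Nat.even_or_odd' y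
    · omega
    · have := ih z w (by omega)
      rw [pcount_two_mul, pcount_two_mul_add_one]; omega
    · have := ih z w (by omega)
      rw [pcount_two_mul, pcount_two_mul_add_one]; omega
    · omega

lemma pcount_rot (d x : ℕ) (hd : 2 ≤ d) (h : x < 2 ^ d - 1) :
    pcount ((2 * x) % (2 ^ d - 1)) = pcount x := by
  obtain ⟨e, rfl⟩ : ∃ e, d = e + 1 := ⟨d - 1, by omega⟩
  have hp : 2 ^ (e + 1) = 2 * 2 ^ e := by ring
  by_cases h2 : 2 * x < 2 ^ (e + 1) - 1
  · rw [Nat.mod_eq_of_lt h2, pcount_two_mul]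
  · rw [Nat.mod_eq_sub_mod (by omega), Nat.mod_eq_of_lt (by omega)]
    obtain ⟨y, rfl⟩ : ∃ y, x = 2 ^ e + y := ⟨x - 2 ^ e, by omega⟩
    rw [show 2 * (2 ^ e + y) - (2 ^ (e + 1) - 1) = 2 * y + 1 by omega, pcount_top e y (by omega),
      pcount_two_mul_add_one]

lemma sBin_rot (d x : ℕ) (hd : 2 ≤ d) : sBin d (2 * x) = sBin d x := by
  rw [sBin_eq, sBin_eq, ← Nat.mul_mod_mod, pcount_rot d _ hd]
  apply Nat.mod_lt
  have : 2 ^ 2 ≤ 2 ^ d := Nat.pow_le_pow_right (by norm_num) hd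
  omega

lemma sBin_mod (d x : ℕ) : sBin d (x % (2 ^ d - 1)) = sBin d x := by
  rw [sBin_eq, sBin_eq, Nat.mod_mod]

lemma pcount_kummer (a b : ℕ) :
    pcount a + pcount b = pcount (a + b) + padicValNat 2 ((a + b).choose a) := by
  have h1 := @sub_one_mul_padicValNat_choose_eq_sub_sum_digits' 2 a b _
  have h2 : (a + b).choose a = (b + a).choose a := by rw [add_comm]
  have hle : ∀ a b : ℕ, pcount (a + b) ≤ pcount a + pcount b := by
    intro a
    induction a using Nat.strong_induction_on with
    | _ a ih =>
    intro b
    have one : ∀ n, pcount (n + 1) ≤ pcount n + 1 := by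
      intro n
      induction n using Nat.strong_induction_on with
      | _ n ihn =>
      obtain ⟨z, rfl | rfl⟩ := Nat.even_or_odd' n
      · rw [pcount_two_mul, pcount_two_mul_add_one]
      · have := ihn z (by omega)
        rw [show 2 * z + 1 + 1 = 2 * (z + 1) by ring, pcount_two_mul, pcount_two_mul_add_one]
        omega
    rcases Nat.eq_zero_or_pos a with rfl | ha
    · simp
    obtain ⟨z, rfl | rfl⟩ := Nat.even_or_odd' a <;> obtain ⟨w, rfl | rfl⟩ := Nat.even_or_odd' b
    · have := ih z (by omega) w
      rw [← mul_add]; simp only [pcount_two_mul]; omega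
    · have := ih z (by omega) w
      rw [← add_assoc, ← mul_add]; simp only [pcount_two_mul, pcount_two_mul_add_one]; omega
    · have := ih z (by omega) w
      rw [show 2 * z + 1 + 2 * w = 2 * (z + w) + 1 by ring]
      simp only [pcount_two_mul, pcount_two_mul_add_one]; omega
    · have := ih z (by omega) w
      have := one (z + w)
      rw [show 2 * z + 1 + (2 * w + 1) = 2 * (z + w + 1) by ring]
      simp only [pcount_two_mul, pcount_two_mul_add_one]; omega
  have h3 := hle a b
  rw [h2]
  unfold pcount at *
  rw [add_comm b a] at *
  omega

lemma pcount_add_le (a b : ℕ) : pcount (a + b) ≤ pcount a + pcount b := by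
  have := pcount_kummer a b; omega

lemma pcount_add_one_le (a : ℕ) : pcount (a + 1) ≤ pcount a + 1 := by
  have := pcount_add_le a 1
  have h := pcount_two_mul_add_one 0
  simp only [mul_zero, zero_add, pcount_zero] at h
  omega

lemma pcount_carry (e a b : ℕ) (ha : a < 2 ^ e) (hb : b < 2 ^ e) (h : 2 ^ e ≤ a + b) :
    pcount (a + b) + 1 ≤ pcount a + pcount b := by
  induction e generalizing a b with
  | zero => omega
  | succ e ih =>
    rw [pow_succ] at ha hb h
    obtain ⟨z, rfl | rfl⟩ := Nat.even_or_odd' a <;> obtain ⟨w, rfl | rfl⟩ := Nat.even_or_odd' b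
    · have := ih z w (by omega) (by omega) (by omega)
      rw [← mul_add]; simp only [pcount_two_mul]; omega
    · have := ih z w (by omega) (by omega) (by omega)
      rw [← add_assoc, ← mul_add]; simp only [pcount_two_mul, pcount_two_mul_add_one]; omega
    · have := ih z w (by omega) (by omega) (by omega)
      rw [show 2 * z + 1 + 2 * w = 2 * (z + w) + 1 by ring]
      simp only [pcount_two_mul, pcount_two_mul_add_one]; omega
    · have := pcount_add_le z w
      have := pcount_add_one_le (z + w)
      rw [show 2 * z + 1 + (2 * w + 1) = 2 * (z + w + 1) by ring]
      simp only [pcount_two_mul, pcount_two_mul_add_one]; omega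

lemma pcount_carry_in (e a b : ℕ) (he : 1 ≤ e) (ha : a < 2 ^ e) (hb : b < 2 ^ e)
    (h : 2 ^ e ≤ a + b + 1) :
    pcount (a + b + 1) ≤ pcount a + pcount b := by
  induction e, he using Nat.le_induction generalizing a b with
  | base =>
    have h1 : pcount 1 = 1 := by simp [pcount]
    have h2 : pcount 2 = 1 := by simp [pcount]
    have h3 : pcount 3 = 2 := by simp [pcount]
    have h0 := pcount_zero
    simp only [pow_one] at ha hb
    interval_cases a <;> interval_cases b <;> simp_all
  | succ e he ih =>
    rw [pow_succ] at ha hb h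
    obtain ⟨z, rfl | rfl⟩ := Nat.even_or_odd' a <;> obtain ⟨w, rfl | rfl⟩ := Nat.even_or_odd' b
    · have := pcount_carry e z w (by omega) (by omega) (by omega)
      rw [← mul_add]; simp only [pcount_two_mul, pcount_two_mul_add_one]; omega
    · have := ih z w (by omega) (by omega) (by omega)
      rw [show 2 * z + (2 * w + 1) + 1 = 2 * (z + w + 1) by ring]
      simp only [pcount_two_mul, pcount_two_mul_add_one]; omega
    · have := ih z w (by omega) (by omega) (by omega)
      rw [show 2 * z + 1 + 2 * w + 1 = 2 * (z + w + 1) by ring]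
      simp only [pcount_two_mul, pcount_two_mul_add_one]; omega
    · have := pcount_add_le z w
      have := pcount_add_one_le (z + w)
      rw [show 2 * z + 1 + (2 * w + 1) + 1 = 2 * (z + w + 1) + 1 by ring]
      simp only [pcount_two_mul, pcount_two_mul_add_one]; omega

/-- the wrap-around case -/
lemma pcount_wrap (d n a b : ℕ) (hd : 2 ≤ d) (ha : a < 2 ^ d) (hb : b < 2 ^ d)
    (hn : n < 2 ^ d) (hev : Even n) (h : a + b + 1 = n + 2 ^ d) :
    pcount n + 2 ≤ pcount a + pcount b := by
  obtain ⟨e, rfl⟩ : ∃ e, d = e + 1 := ⟨d - 1, by omega⟩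
  obtain ⟨k, rfl⟩ := even_iff_exists_two_mul.mp hev
  have hp : 2 ^ (e + 1) = 2 * 2 ^ e := by ring
  rw [hp] at *
  have key : ∀ z w : ℕ, z < 2 ^ e → w < 2 ^ e → z + w + 1 = k + 2 ^ e →
      pcount k + 1 ≤ pcount z + pcount w := by
    intro z w hz hw hs
    have h1 := pcount_carry_in e z w (by omega) hz hw (by omega)
    rw [hs, add_comm, pcount_top e k (by omega)] at h1
    exact h1
  rw [pcount_two_mul]
  obtain ⟨z, rfl | rfl⟩ := Nat.even_or_odd' a <;> obtain ⟨w, rfl | rfl⟩ := Nat.even_or_odd' b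
  · omega
  · have := key z w (by omega) (by omega) (by omega)
    simp only [pcount_two_mul, pcount_two_mul_add_one]; omega
  · have := key z w (by omega) (by omega) (by omega)
    simp only [pcount_two_mul, pcount_two_mul_add_one]; omega
  · omega

/-- For `n ≡ -5a` even, membership in `S` is `a ≤ n` with the binomial exactly divisible by 2. -/
lemma mem_S_iff (d a n : ℕ) (hd : 3 ≤ d) (h0 : 0 < a) (ha : a < 2 ^ d - 1)
    (h3 : Nat.Coprime 3 (2 ^ d - 1)) (h5 : Nat.Coprime 5 (2 ^ d - 1))
    (hn : n < 2 ^ d - 1) (hev : Even n) (h : (2 ^ d - 1) ∣ 5 * a + n) :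
    sBin d a + sBin d (5 * a) = sBin d (6 * a) + 1 ↔
      (a ≤ n ∧ padicValNat 2 (n.choose a) = 1) := by
  have hM : 2 ^ 3 ≤ 2 ^ d := Nat.pow_le_pow_right (by norm_num) hd
  have hnd : ¬ (2 ^ d - 1) ∣ a := fun hh => by
    have := Nat.le_of_dvd h0 hh; omega
  set M := 2 ^ d - 1 with hMd
  have hdM : 2 ^ d = M + 1 := by omega
  have h5a : ¬ M ∣ 5 * a := fun hh => hnd ((Nat.Coprime.symm h5).dvd_of_dvd_mul_left hh)
  have hodd : Nat.Coprime 2 M := by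
    rw [Nat.coprime_two_left]
    have : Even (2 ^ d) := (Nat.even_pow.mpr ⟨even_two, by omega⟩)
    rw [hdM] at this
    exact Nat.not_even_iff_odd.mp (fun h => by
      have := Nat.even_add_one.mp this; exact this h)
  have h6a : ¬ M ∣ 6 * a := fun hh => by
    rw [show 6 * a = 2 * (3 * a) by ring] at hh
    exact hnd ((Nat.Coprime.symm h3).dvd_of_dvd_mul_left ((Nat.Coprime.symm hodd).dvd_of_dvd_mul_left hh))
  -- complement
  have c5 : sBin d (5 * a) + pcount n = d := by
    rw [sBin_eq]
    apply pcount_compl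
    have hlt := Nat.mod_lt (5 * a) (show 0 < M by omega)
    have hne : (5 * a) % M ≠ 0 := fun hh => h5a (Nat.dvd_of_mod_eq_zero hh)
    have hdv : M ∣ (5 * a) % M + n := by
      rw [← Nat.modEq_zero_iff_dvd] at h ⊢
      exact ((Nat.mod_modEq _ _).add_right n).trans h
    obtain ⟨c, hc⟩ := hdv
    have : c = 1 := by
      have h1 : c < 2 := by
        by_contra hcon
        have : M * 2 ≤ M * c := Nat.mul_le_mul_left _ (by omega)
        omega
      have h2 : c ≠ 0 := by rintro rfl; omega
      omega
    subst this
    rw [← hMd]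
    omega
  have c6 : ∀ b, b ≤ M → M ∣ 6 * a + b → sBin d (6 * a) + pcount b = d := by
    intro b hb hbd
    rw [sBin_eq]
    apply pcount_compl
    have hlt := Nat.mod_lt (6 * a) (show 0 < M by omega)
    have hne : (6 * a) % M ≠ 0 := fun hh => h6a (Nat.dvd_of_mod_eq_zero hh)
    have hdv : M ∣ (6 * a) % M + b := by
      rw [← Nat.modEq_zero_iff_dvd] at hbd ⊢
      exact ((Nat.mod_modEq _ _).add_right b).trans hbd
    obtain ⟨c, hc⟩ := hdv
    have : c = 1 := by
      have h1 : c < 2 := by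
        by_contra hcon
        have : M * 2 ≤ M * c := Nat.mul_le_mul_left _ (by omega)
        omega
      have h2 : c ≠ 0 := by rintro rfl; omega
      omega
    subst this
    rw [← hMd]
    omega
  have sa : sBin d a = pcount a := by rw [sBin_eq, Nat.mod_eq_of_lt ha]
  rw [sa]
  by_cases hle : a ≤ n
  · obtain ⟨b, rfl⟩ := Nat.exists_eq_add_of_le hle
    have := c6 b (by omega) (by rw [show 6 * a + b = 5 * a + (a + b) by ring]; exact h)
    have := pcount_kummer a b
    constructor
    · intro hh; exact ⟨hle, by omega⟩
    · rintro ⟨-, hh⟩; omega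
  · have hb := c6 (n + M - a) (by omega) (by
      have : 6 * a + (n + M - a) = (5 * a + n) + M := by omega
      rw [this]; exact Dvd.dvd.add h (dvd_refl _) )
    have := pcount_wrap d n a (n + M - a) (by omega) (by omega) (by omega) (by omega) hev (by omega)
    constructor
    · intro hh; omega
    · rintro ⟨hh, -⟩; omega

lemma cop3 (d : ℕ) (h : Odd d) : Nat.Coprime 3 (2 ^ d - 1) := by
  obtain ⟨k, rfl⟩ := h
  have h1 : (2 ^ (2 * k + 1)) % 3 = 2 := by
    rw [pow_succ, pow_mul, Nat.mul_mod, Nat.pow_mod]; norm_num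
  rw [Nat.Prime.coprime_iff_not_dvd (by norm_num)]
  generalize 2 ^ (2 * k + 1) = X at *
  omega

lemma cop5 (d : ℕ) (h : Odd d) : Nat.Coprime 5 (2 ^ d - 1) := by
  obtain ⟨k, rfl⟩ := h
  have h1 : (2 ^ (2 * k + 1)) % 5 = 2 ∨ (2 ^ (2 * k + 1)) % 5 = 3 := by
    induction k with
    | zero => norm_num
    | succ k ih =>
      have : 2 ^ (2 * (k + 1) + 1) = 4 * 2 ^ (2 * k + 1) := by ring
      omega
  rw [Nat.Prime.coprime_iff_not_dvd (by norm_num)]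
  generalize 2 ^ (2 * k + 1) = X at *
  omega

section field
variable {F : Type*} [Field F] [Fintype F] [CharP F 2] {d : ℕ}

lemma eq_one_of_pow (hc : Fintype.card F = 2 ^ d) (m : ℕ) (hm : Nat.Coprime m (2 ^ d - 1))
    (t : F) (ht : t ^ m = 1) (h0 : t ≠ 0) : t = 1 := by
  have h1 := FiniteField.pow_card_sub_one_eq_one t h0
  rw [hc] at h1
  have h2 := orderOf_dvd_of_pow_eq_one ht
  have h3 := orderOf_dvd_of_pow_eq_one h1
  have := Nat.dvd_gcd h2 h3
  rw [hm] at this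
  exact orderOf_eq_one_iff.mp (Nat.dvd_one.mp this)

lemma no_cube_root (hodd : Odd d) (hc : Fintype.card F = 2 ^ d) (t : F) : t ^ 2 + t + 1 ≠ 0 := by
  intro h
  have h2 : (2 : F) = 0 := CharTwo.two_eq_zero
  have h3 : t ^ 3 = 1 := by linear_combination (t - 1) * h
  have h0 : t ≠ 0 := by rintro rfl; simp at h
  have := eq_one_of_pow hc 3 (cop3 d hodd) t h3 h0
  subst this
  apply one_ne_zero (α := F)
  linear_combination h - h2

lemma dickson_inj (hodd : Odd d) (hc : Fintype.card F = 2 ^ d) :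
    Function.Injective (fun u : F => u ^ 5 + u ^ 3 + u) := by
  intro u v h
  have h2 : (2 : F) = 0 := CharTwo.two_eq_zero
  simp only at h
  by_contra hne
  have hs : u - v ≠ 0 := sub_ne_zero.mpr hne
  have key : (u ^ 2 + v ^ 2 + 1) ^ 2 + (u ^ 2 + v ^ 2 + 1) * (u * v + 1) + (u * v + 1) ^ 2 = 0 := by
    apply mul_left_cancel₀ hs
    grind
  by_cases hB : u * v + 1 = 0
  · have hA : u ^ 2 + v ^ 2 + 1 = 0 := by
      rw [hB] at key
      have : (u ^ 2 + v ^ 2 + 1) ^ 2 = 0 := by linear_combination key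
      exact pow_eq_zero_iff (two_ne_zero) |>.mp this
    have h1 : (u + v + 1) ^ 2 = 0 := by grind
    have h1' : u + v + 1 = 0 := pow_eq_zero_iff (two_ne_zero) |>.mp h1
    apply no_cube_root hodd hc u
    grind
  · apply no_cube_root hodd hc ((u ^ 2 + v ^ 2 + 1) / (u * v + 1))
    field_simp
    linear_combination key

/-- the basic two-to-one map -/
def segre (x : F) : F := x ^ 6 + x

open Classical in
lemma segre_fiber (hodd : Odd d) (hc : Fintype.card F = 2 ^ d) (v : F)
    (hv : v ∈ Finset.univ.image (segre (F := F))) :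
    (Finset.univ.filter (fun x : F => segre x = v)).card = 2 := by
  have h2 : (2 : F) = 0 := CharTwo.two_eq_zero
  have hx : ∃ x : F, x ≠ 0 ∧ segre x = v := by
    obtain ⟨x, -, hx⟩ := Finset.mem_image.mp hv
    by_cases h0 : x = 0
    · refine ⟨1, one_ne_zero, ?_⟩
      rw [← hx, h0]; unfold segre; linear_combination h2
    · exact ⟨x, h0, hx⟩
  obtain ⟨x, h0, rfl⟩ := hx
  obtain ⟨u, hu⟩ := (Finite.injective_iff_surjective.mp (dickson_inj hodd hc)) ((x ^ 5)⁻¹)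
  simp only at hu
  have hu' : x ^ 5 * (u ^ 5 + u ^ 3 + u) = 1 := by rw [hu]; field_simp
  have hu0 : u ≠ 0 := by rintro rfl; simp at hu'
  have : Finset.univ.filter (fun y : F => segre y = segre x) = {x, x * (u + 1)} := by
    ext y
    simp only [Finset.mem_filter, Finset.mem_univ, true_and, Finset.mem_insert,
      Finset.mem_singleton]
    obtain ⟨w, rfl⟩ : ∃ w, y = x * (w + 1) := ⟨y / x - 1, by field_simp; ring⟩
    have hfac : segre (x * (w + 1)) - segre x = x * w * (x ^ 5 * (w ^ 5 + w ^ 3 + w) - 1) := by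
      unfold segre
      grind
    constructor
    · intro h
      rw [h, sub_self] at hfac
      rcases mul_eq_zero.mp hfac.symm with h | h
      · left
        have : w = 0 := (mul_eq_zero.mp h).resolve_left h0
        rw [this]; ring
      · right
        have hw : w ^ 5 + w ^ 3 + w = u ^ 5 + u ^ 3 + u := by
          apply mul_left_cancel₀ (pow_ne_zero 5 h0)
          linear_combination h - hu'
        rw [dickson_inj hodd hc hw]
    · rintro (h | h)
      · rw [h]
      · have : w = u := by
          have := mul_left_cancel₀ h0 h
          linear_combination this
        subst this
        rw [hu', sub_self, mul_zero] at hfac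
        exact sub_eq_zero.mp hfac
  rw [this, Finset.card_pair]
  intro h
  apply hu0
  apply mul_left_cancel₀ h0
  linear_combination -h

open Classical in
lemma segre_sum (hodd : Odd d) (hc : Fintype.card F = 2 ^ d) {R : Type*} [CommRing R] (g : F → R) :
    ∑ x : F, g (segre x) = 2 * ∑ v ∈ Finset.univ.image (segre (F := F)), g v := by
  rw [Finset.sum_comp g segre, Finset.mul_sum]
  apply Finset.sum_congr rfl
  intro v hv
  rw [segre_fiber hodd hc v hv]
  simp

open Classical in
lemma segre_card (hodd : Odd d) (hd : 3 ≤ d) (hc : Fintype.card F = 2 ^ d) :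
    Odd ((Finset.univ.image (segre (F := F))).erase 0).card := by
  have h := segre_sum (F := F) hodd hc (R := ℤ) (fun _ => 1)
  simp only [Finset.sum_const, Finset.card_univ, hc, nsmul_eq_mul, mul_one] at h
  norm_cast at h
  obtain ⟨e, rfl⟩ : ∃ e, d = e + 2 := ⟨d - 2, by omega⟩
  have hp : 2 ^ (e + 2) = 4 * 2 ^ e := by ring
  rw [Finset.card_erase_of_mem]
  · have : 0 < 2 ^ e := by positivity
    rw [Nat.odd_iff]; omega
  · exact Finset.mem_image.mpr ⟨0, by simp, by simp [segre]⟩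

lemma exists_pow_ne (hc : Fintype.card F = 2 ^ d) (m : ℕ) (hm : ¬ (2 ^ d - 1) ∣ m) :
    ∃ g : F, g ≠ 0 ∧ g ^ m ≠ 1 := by
  obtain ⟨g, hg⟩ := IsCyclic.exists_generator (α := Fˣ)
  refine ⟨g, g.ne_zero, fun h => hm ?_⟩
  have h1 : g ^ m = 1 := by ext; simpa using h
  have h2 := orderOf_dvd_of_pow_eq_one h1
  rwa [orderOf_eq_card_of_forall_mem_zpowers hg, Nat.card_units, Nat.card_eq_fintype_card, hc]
    at h2

local notation "τ" => WittVector.teichmuller 2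

lemma teich_sum (hc : Fintype.card F = 2 ^ d) (m : ℕ) (hm0 : 0 < m) :
    ∑ x : F, (τ x) ^ m = if (2 ^ d - 1) ∣ m then ((2 ^ d - 1 : ℕ) : WittVector 2 F) else 0 := by
  classical
  split_ifs with h
  · rw [← Finset.add_sum_erase _ _ (Finset.mem_univ (0 : F))]
    have : ∀ x ∈ Finset.univ.erase (0 : F), (τ x) ^ m = 1 := by
      intro x hx
      obtain ⟨k, rfl⟩ := h
      rw [← map_pow, pow_mul, ← hc, FiniteField.pow_card_sub_one_eq_one x (Finset.ne_of_mem_erase hx)]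
      simp
    rw [Finset.sum_congr rfl this, WittVector.teichmuller_zero, zero_pow hm0.ne']
    simp [hc]
  · obtain ⟨g, hg0, hg⟩ := exists_pow_ne hc m h
    have h1 : (τ g) ^ m * ∑ x : F, (τ x) ^ m = ∑ x : F, (τ x) ^ m := by
      rw [Finset.mul_sum]
      refine Fintype.sum_bijective (fun x => g * x) (mulLeft_bijective₀ g hg0) _ _ ?_
      intro x
      rw [map_mul, mul_pow]
    have h2 : ((τ g) ^ m - 1) * ∑ x : F, (τ x) ^ m = 0 := by
      rw [sub_mul, h1]; ring
    rcases mul_eq_zero.mp h2 with h3 | h3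
    · exfalso
      apply hg
      have := congrArg WittVector.constantCoeff (sub_eq_zero.mp h3)
      rw [← map_pow, map_one, WittVector.constantCoeff_apply,
        WittVector.teichmuller_coeff_zero] at this
      exact this
    · exact h3

lemma witt_dvd_two (x : WittVector 2 F) (hx : WittVector.constantCoeff x = 0) : ∃ y, x = 2 * y := by
  have := (WittVector.mem_span_p_iff_coeff_zero_eq_zero (p := 2) x).mpr hx
  rw [Ideal.mem_span_singleton] at this
  exact_mod_cast this

/-- lifting to characteristic zero -/
lemma witt_pow_congr (x : F) (n : ℕ) (hn : Even n) :
    ∃ y, (τ (segre x)) ^ n = ((τ x) ^ 6 + τ x) ^ n + 4 * y := by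
  obtain ⟨k, rfl⟩ := even_iff_exists_two_mul.mp hn
  obtain ⟨z, hz⟩ := witt_dvd_two (τ (segre x) - ((τ x) ^ 6 + τ x)) (by
    rw [map_sub, map_add, map_pow]
    simp only [WittVector.constantCoeff_apply, WittVector.teichmuller_coeff_zero, segre, sub_self])
  have h1 : (4 : WittVector 2 F) ∣ (τ (segre x)) ^ 2 - ((τ x) ^ 6 + τ x) ^ 2 := by
    refine ⟨z * ((τ x) ^ 6 + τ x) + z ^ 2, ?_⟩
    rw [show τ (segre x) = ((τ x) ^ 6 + τ x) + 2 * z by rw [← hz]; ring]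
    ring
  have h2 := h1.trans (sub_dvd_pow_sub_pow ((τ (segre x)) ^ 2) (((τ x) ^ 6 + τ x) ^ 2) k)
  obtain ⟨y, hy⟩ := h2
  refine ⟨y, ?_⟩
  rw [pow_mul, pow_mul, ← hy]; ring

lemma witt_binom (hc : Fintype.card F = 2 ^ d) (a n : ℕ) (h5 : Nat.Coprime 5 (2 ^ d - 1))
    (ha : a < 2 ^ d - 1) (hn0 : 0 < n) (hn : n < 2 ^ d - 1) (h : (2 ^ d - 1) ∣ 5 * a + n) :
    ∑ x : F, ((τ x) ^ 6 + τ x) ^ n =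
      (((2 ^ d - 1 : ℕ) * n.choose a : ℕ) : WittVector 2 F) := by
  have h1 : ∀ x : F, ((τ x) ^ 6 + τ x) ^ n =
      ∑ j ∈ Finset.range (n + 1), (τ x) ^ (5 * j + n) * (n.choose j : WittVector 2 F) := by
    intro x
    rw [add_pow]
    apply Finset.sum_congr rfl
    intro j hj
    have : j ≤ n := by simpa [Nat.lt_succ_iff] using hj
    rw [← pow_mul, ← pow_add]
    congr 2
    omega
  simp_rw [h1]
  rw [Finset.sum_comm]
  have h1' : ∀ j, ∑ x : F, (τ x) ^ (5 * j + n) = if (2 ^ d - 1) ∣ 5 * j + n then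
      ((2 ^ d - 1 : ℕ) : WittVector 2 F) else 0 := fun j => teich_sum hc _ (by omega)
  simp_rw [← Finset.sum_mul, h1']
  have h2 : ∀ j ∈ Finset.range (n + 1), ((if (2 ^ d - 1) ∣ 5 * j + n then
      ((2 ^ d - 1 : ℕ) : WittVector 2 F) else 0) * (n.choose j : WittVector 2 F)) =
      if j = a then (((2 ^ d - 1 : ℕ) * n.choose a : ℕ) : WittVector 2 F) else 0 := by
    intro j hj
    have hj' : j ≤ n := by simpa [Nat.lt_succ_iff] using hj
    have : (2 ^ d - 1) ∣ 5 * j + n ↔ j = a := by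
      constructor
      · intro hh
        have e1 : 5 * j + n ≡ 5 * a + n [MOD 2 ^ d - 1] :=
          ((Nat.modEq_zero_iff_dvd).mpr hh).trans ((Nat.modEq_zero_iff_dvd).mpr h).symm
        have e2 := Nat.ModEq.add_right_cancel' n e1
        have e3 := Nat.ModEq.cancel_left_of_coprime (by rw [Nat.gcd_comm]; exact h5) e2
        exact Nat.ModEq.eq_of_lt_of_lt e3 (by omega) ha
      · rintro rfl; exact h
    by_cases hja : j = a
    · rw [if_pos (this.mpr hja), if_pos hja, hja]; push_cast; ring
    · rw [if_neg (fun hh => hja (this.mp hh)), if_neg hja, zero_mul]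
  rw [Finset.sum_congr rfl h2, Finset.sum_ite_eq']
  split_ifs with hm
  · rfl
  · have : n < a := by simpa [Nat.lt_succ_iff] using hm
    rw [Nat.choose_eq_zero_of_lt this]; simp

open Classical in
lemma power_sum_even (hodd : Odd d) (hd : 3 ≤ d) (hc : Fintype.card F = 2 ^ d) (a n : ℕ)
    (h0 : 0 < a) (ha : a < 2 ^ d - 1) (hn0 : 0 < n) (hn : n < 2 ^ d - 1) (hev : Even n)
    (h : (2 ^ d - 1) ∣ 5 * a + n) :
    ∑ v ∈ (Finset.univ.image (segre (F := F))).erase 0, v ^ n =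
      if sBin d a + sBin d (5 * a) = sBin d (6 * a) + 1 then 1 else 0 := by
  have e1 := segre_sum (F := F) hodd hc (fun v => (τ v) ^ n)
  choose y hy using fun x : F => witt_pow_congr x n hev
  simp_rw [hy] at e1
  rw [Finset.sum_add_distrib, witt_binom hc a n (cop5 d hodd) ha hn0 hn h, ← Finset.mul_sum] at e1
  have hchar : (2 : F) = 0 := CharTwo.two_eq_zero
  have hM : Odd (2 ^ d - 1) := by
    have h8 : 2 ^ 3 ≤ 2 ^ d := Nat.pow_le_pow_right (by norm_num) hd
    have : 2 ∣ 2 ^ d := dvd_pow_self 2 (by omega)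
    rw [Nat.odd_iff]; omega
  have hM1 : ((2 ^ d - 1 : ℕ) : F) = 1 := by
    obtain ⟨k, hk⟩ := hM
    rw [hk]; push_cast; rw [hchar]; ring
  have hcc : ∀ m : ℕ, WittVector.constantCoeff ((m : ℕ) : WittVector 2 F) = (m : F) :=
    fun m => map_natCast _ m
  have h4 : WittVector.constantCoeff (4 : WittVector 2 F) = 0 := by
    rw [map_ofNat]; linear_combination 2 * hchar
  have h2' : WittVector.constantCoeff (2 : WittVector 2 F) = 0 := by
    rw [map_ofNat]; exact hchar
  have evC : Even (n.choose a) := by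
    have := congrArg WittVector.constantCoeff e1
    rw [map_add, map_mul, map_mul, h4, h2', hcc, zero_mul, zero_mul, add_zero, Nat.cast_mul, hM1,
      one_mul, CharP.cast_eq_zero_iff F 2] at this
    exact even_iff_two_dvd.mpr this
  obtain ⟨c, hcC⟩ := even_iff_exists_two_mul.mp evC
  have e2 : ∑ v ∈ Finset.univ.image (segre (F := F)), (τ v) ^ n =
      (((2 ^ d - 1 : ℕ) * c : ℕ) : WittVector 2 F) + 2 * ∑ x : F, y x := by
    have h20 : (2 : WittVector 2 F) ≠ 0 := by
      have := WittVector.p_nonzero 2 F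
      exact_mod_cast this
    apply mul_left_cancel₀ h20
    rw [← e1, hcC]
    push_cast
    ring
  have e3 := congrArg WittVector.constantCoeff e2
  rw [map_add, map_mul, h2', hcc, Nat.cast_mul, hM1, one_mul, zero_mul, add_zero, map_sum] at e3
  simp only [map_pow, WittVector.constantCoeff_apply, WittVector.teichmuller_coeff_zero] at e3
  rw [← Finset.add_sum_erase _ _ (show (0 : F) ∈ Finset.univ.image (segre (F := F)) from
    Finset.mem_image.mpr ⟨0, by simp, by simp [segre]⟩), zero_pow hn0.ne', zero_add] at e3
  rw [e3]
  have iff1 := mem_S_iff d a n hd h0 ha (cop3 d hodd) (cop5 d hodd) hn hev h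
  have iff2 : (a ≤ n ∧ padicValNat 2 (n.choose a) = 1) ↔ Odd c := by
    rw [hcC]
    by_cases hc0 : c = 0
    · subst hc0; simp
    · have hle : a ≤ n := by
        by_contra hcon
        rw [Nat.choose_eq_zero_of_lt (by omega)] at hcC
        omega
      rw [padicValNat.mul (by norm_num) hc0, padicValNat.self (by norm_num)]
      constructor
      · rintro ⟨-, hh⟩
        by_contra hcon
        rw [Nat.not_odd_iff_even, even_iff_two_dvd] at hcon
        have := one_le_padicValNat_of_dvd hc0 hcon
        omega
      · intro hh
        refine ⟨hle, ?_⟩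
        rw [padicValNat.eq_zero_of_not_dvd]
        rw [← even_iff_two_dvd]; exact Nat.not_even_iff_odd.mpr hh
  rw [iff2] at iff1
  split_ifs with hS
  · obtain ⟨k, hk⟩ := iff1.mp hS
    rw [hk]; push_cast; rw [hchar]; ring
  · have : Even c := Nat.not_odd_iff_even.mp (fun hh => hS (iff1.mpr hh))
    obtain ⟨k, hk⟩ := even_iff_exists_two_mul.mp this
    rw [hk]; push_cast; rw [hchar]; ring

lemma cond_double (hd : 3 ≤ d) (a : ℕ) :
    (sBin d ((2 * a) % (2 ^ d - 1)) + sBin d (5 * ((2 * a) % (2 ^ d - 1))) =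
      sBin d (6 * ((2 * a) % (2 ^ d - 1))) + 1) ↔
    sBin d a + sBin d (5 * a) = sBin d (6 * a) + 1 := by
  have e : ∀ m, sBin d (m * ((2 * a) % (2 ^ d - 1))) = sBin d (m * a) := by
    intro m
    rw [← sBin_mod, Nat.mul_mod_mod, sBin_mod, show m * (2 * a) = 2 * (m * a) by ring,
      sBin_rot d _ (by omega)]
  have e1 := e 1
  rw [one_mul, one_mul] at e1
  rw [e, e, e1]

open Classical in
lemma power_sum (hodd : Odd d) (hd : 3 ≤ d) (hc : Fintype.card F = 2 ^ d) (n : ℕ) :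
    ∀ a : ℕ, 0 < a → a < 2 ^ d - 1 → 0 < n → n < 2 ^ d - 1 → (2 ^ d - 1) ∣ 5 * a + n →
    ∑ v ∈ (Finset.univ.image (segre (F := F))).erase 0, v ^ n =
      if sBin d a + sBin d (5 * a) = sBin d (6 * a) + 1 then 1 else 0 := by
  induction n using Nat.strong_induction_on with
  | _ n ih =>
  intro a h0 ha hn0 hn h
  rcases Nat.even_or_odd n with hev | hno
  · exact power_sum_even hodd hd hc a n h0 ha hn0 hn hev h
  have h8 : 2 ^ 3 ≤ 2 ^ d := Nat.pow_le_pow_right (by norm_num) hd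
  have hMo : Odd (2 ^ d - 1) := by
    have : 2 ∣ 2 ^ d := dvd_pow_self 2 (by omega)
    rw [Nat.odd_iff]; omega
  set M := 2 ^ d - 1 with hM
  have ha' : 0 < (2 * a) % M := by
    rw [Nat.pos_iff_ne_zero]
    intro hh
    have h1 : M ∣ 2 * a := Nat.dvd_of_mod_eq_zero hh
    have h2 : M ∣ a := (Nat.coprime_two_right.mpr hMo).dvd_of_dvd_mul_left h1
    have := Nat.le_of_dvd h0 h2
    omega
  have ha'' : (2 * a) % M < M := Nat.mod_lt _ (by omega)
  have hsq : ∑ v ∈ (Finset.univ.image (segre (F := F))).erase 0, v ^ (2 * n) =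
      if sBin d a + sBin d (5 * a) = sBin d (6 * a) + 1 then 1 else 0 := by
    have hdiv : ∀ n', n' ≡ 2 * n [MOD M] → M ∣ 5 * ((2 * a) % M) + n' := by
      intro n' hn'
      rw [← Nat.modEq_zero_iff_dvd]
      have h1 : 5 * ((2 * a) % M) + n' ≡ 5 * (2 * a) + 2 * n [MOD M] :=
        Nat.ModEq.add ((Nat.mod_modEq _ _).mul_left 5) hn'
      refine h1.trans ?_
      rw [Nat.modEq_zero_iff_dvd]
      obtain ⟨k, hk⟩ := h
      exact ⟨2 * k, by rw [show M * (2 * k) = 2 * (M * k) by ring, ← hk]; ring⟩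
    by_cases hlt : 2 * n < M
    · have := power_sum_even (F := F) hodd hd hc ((2 * a) % M) (2 * n) ha' ha'' (by omega) hlt (by simp)
        (hdiv _ rfl)
      rw [this]
      simp only [hM, cond_double hd a]
    · have hne : 2 * n ≠ M := by
        intro hh; rw [← hh] at hMo; exact absurd hMo (by simp)
      have := ih (2 * n - M) (by omega) ((2 * a) % M) ha' ha'' (by omega) (by omega)
        (hdiv _ (by
          have : 2 * n - M + M = 2 * n := by omega
          conv_rhs => rw [← this]
          simp [Nat.ModEq]))
      simp only [hM, cond_double hd a] at this
      rw [← this]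
      apply Finset.sum_congr rfl
      intro v hv
      have hv0 := Finset.ne_of_mem_erase hv
      have h1 := FiniteField.pow_card_sub_one_eq_one v hv0
      rw [hc] at h1
      rw [show 2 * n = (2 * n - M) + (2 ^ d - 1) by omega, pow_add, h1, mul_one]
      congr 1; omega
  have hsq2 : (∑ v ∈ (Finset.univ.image (segre (F := F))).erase 0, v ^ n) ^ 2 =
      ∑ v ∈ (Finset.univ.image (segre (F := F))).erase 0, v ^ (2 * n) := by
    rw [CharTwo.sum_sq]
    apply Finset.sum_congr rfl
    intro v _
    rw [← pow_mul, mul_comm]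
  rw [hsq] at hsq2
  split_ifs with hS
  · rw [if_pos hS] at hsq2
    have h2 : (2 : F) = 0 := CharTwo.two_eq_zero
    have : (∑ v ∈ (Finset.univ.image (segre (F := F))).erase 0, v ^ n - 1) ^ 2 = 0 := by
      linear_combination hsq2 + (1 - ∑ v ∈ (Finset.univ.image (segre (F := F))).erase 0, v ^ n) * h2
    exact sub_eq_zero.mp (pow_eq_zero_iff two_ne_zero |>.mp this)
  · rw [if_neg hS] at hsq2
    exact pow_eq_zero_iff two_ne_zero |>.mp hsq2

open Classical in
lemma power_sum_inv (hodd : Odd d) (hd : 3 ≤ d) (hc : Fintype.card F = 2 ^ d)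
    (a : ℕ) (h0 : 0 < a) (ha : a < 2 ^ d - 1) :
    ∑ v ∈ (Finset.univ.image (segre (F := F))).erase 0, v⁻¹ ^ (5 * a) =
      if sBin d a + sBin d (5 * a) = sBin d (6 * a) + 1 then 1 else 0 := by
  have hmlt := Nat.mod_lt (5 * a) (show 0 < 2 ^ d - 1 by omega)
  have hm0 : (5 * a) % (2 ^ d - 1) ≠ 0 := by
    intro hh
    have h1 := Nat.dvd_of_mod_eq_zero hh
    have h2 := (cop5 d hodd).symm.dvd_of_dvd_mul_left h1
    have := Nat.le_of_dvd h0 h2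
    omega
  have hdm := Nat.mod_add_div (5 * a) (2 ^ d - 1)
  have hdvd : (2 ^ d - 1) ∣ 5 * a + (2 ^ d - 1 - (5 * a) % (2 ^ d - 1)) := by
    refine ⟨5 * a / (2 ^ d - 1) + 1, ?_⟩
    rw [mul_add, mul_one]
    omega
  rw [← power_sum (F := F) hodd hd hc (2 ^ d - 1 - (5 * a) % (2 ^ d - 1)) a h0 ha (by omega)
    (by omega) hdvd]
  apply Finset.sum_congr rfl
  intro v hv
  have hv0 := Finset.ne_of_mem_erase hv
  have h1 := FiniteField.pow_card_sub_one_eq_one v hv0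
  rw [hc] at h1
  rw [inv_pow, inv_eq_iff_eq_inv, eq_comm, inv_eq_iff_eq_inv]
  apply eq_inv_of_mul_eq_one_right
  rw [← pow_add]
  obtain ⟨k, hk⟩ := hdvd
  rw [hk, pow_mul, h1, one_pow]

open Classical in
lemma main_indicator (hodd : Odd d) (hd : 3 ≤ d) (hc : Fintype.card F = 2 ^ d)
    (β : F) (hβ : β ≠ 0) :
    (if β ∈ Finset.univ.image (segre (F := F)) then (1 : F) else 0) =
      1 + ∑ a ∈ (Finset.Ico 1 (2 ^ d - 1)).filter
        (fun a => sBin d a + sBin d (5 * a) = sBin d (6 * a) + 1), β ^ (5 * a) := by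
  have h8 : 2 ^ 3 ≤ 2 ^ d := Nat.pow_le_pow_right (by norm_num) hd
  have hchar : (2 : F) = 0 := CharTwo.two_eq_zero
  have hM : Odd (2 ^ d - 1) := by
    have : 2 ∣ 2 ^ d := dvd_pow_self 2 (by omega)
    rw [Nat.odd_iff]; omega
  have hM1 : ((2 ^ d - 1 : ℕ) : F) = 1 := by
    obtain ⟨k, hk⟩ := hM
    rw [hk]; push_cast; rw [hchar]; ring
  have orth : ∀ v ∈ (Finset.univ.image (segre (F := F))).erase 0,
      ∑ a ∈ Finset.range (2 ^ d - 1), β ^ (5 * a) * v⁻¹ ^ (5 * a) = if β = v then 1 else 0 := by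
    intro v hv
    have hv0 := Finset.ne_of_mem_erase hv
    have e : ∀ a, β ^ (5 * a) * v⁻¹ ^ (5 * a) = ((β * v⁻¹) ^ 5) ^ a := by
      intro a; rw [← mul_pow, pow_mul]
    simp_rw [e]
    split_ifs with hh
    · rw [hh, mul_inv_cancel₀ hv0]; simpa using hM1
    · have hz0 : β * v⁻¹ ≠ 0 := mul_ne_zero hβ (inv_ne_zero hv0)
      have hz : (β * v⁻¹) ^ 5 ≠ 1 := by
        intro h5
        have := eq_one_of_pow hc 5 (cop5 d hodd) _ h5 hz0
        apply hh
        field_simp at this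
        exact this
      have h1 := FiniteField.pow_card_sub_one_eq_one _ (pow_ne_zero 5 hz0)
      rw [hc] at h1
      rw [geom_sum_eq hz, h1]; simp
  have tot : ∑ a ∈ Finset.range (2 ^ d - 1), β ^ (5 * a) *
      ∑ v ∈ (Finset.univ.image (segre (F := F))).erase 0, v⁻¹ ^ (5 * a) =
      (if β ∈ Finset.univ.image (segre (F := F)) then (1 : F) else 0) := by
    simp_rw [Finset.mul_sum]
    rw [Finset.sum_comm, Finset.sum_congr rfl orth, Finset.sum_ite_eq]
    simp only [Finset.mem_erase, hβ, ne_eq, not_false_eq_true, true_and]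
  rw [← tot, Finset.range_eq_Ico, Finset.sum_eq_sum_Ico_succ_bot (by omega)]
  congr 1
  · obtain ⟨k, hk⟩ := segre_card (F := F) hodd hd hc
    simp only [mul_zero, pow_zero, Finset.sum_const, nsmul_eq_mul, mul_one, one_mul, hk]
    push_cast; rw [hchar]; ring
  · rw [Finset.sum_filter]
    apply Finset.sum_congr rfl
    intro a ha
    rw [Finset.mem_Ico] at ha
    rw [power_sum_inv hodd hd hc a (by omega) (by omega)]
    split_ifs <;> simp

end field

lemma cond_pow {d : ℕ} (hd : 3 ≤ d) (b i : ℕ)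
    (h : sBin d b + sBin d (5 * b) = sBin d (6 * b) + 1) :
    sBin d ((2 ^ i * b) % (2 ^ d - 1)) + sBin d (5 * ((2 ^ i * b) % (2 ^ d - 1))) =
      sBin d (6 * ((2 ^ i * b) % (2 ^ d - 1))) + 1 := by
  have e : ∀ m, sBin d (m * ((2 ^ i * b) % (2 ^ d - 1))) = sBin d (m * b) := by
    intro m
    rw [← sBin_mod, Nat.mul_mod_mod, sBin_mod]
    induction i with
    | zero => simp
    | succ i ih =>
      rw [show m * (2 ^ (i + 1) * b) = 2 * (m * (2 ^ i * b)) by ring, sBin_rot d _ (by omega), ih]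
  have e1 := e 1
  rw [one_mul, one_mul] at e1
  rw [e, e, e1, h]

theorem stmt_13 (d : ℕ) (hodd : Odd d) (hd : 3 ≤ d)
    (J : Finset ℕ)
    (hJsub : ∀ b ∈ J, 0 < b ∧ b < 2 ^ d - 1 ∧
      sBin d b + sBin d (5 * b) = sBin d (6 * b) + 1)
    (hrep : ∀ a : ℕ, 0 < a → a < 2 ^ d - 1 →
      sBin d a + sBin d (5 * a) = sBin d (6 * a) + 1 →
      ∃! bi : ℕ × ℕ, bi.1 ∈ J ∧ bi.2 < d ∧ a ≡ 2 ^ bi.2 * bi.1 [MOD 2 ^ d - 1])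
    (β : GaloisField 2 d) (hβ : β ≠ 0) :
    {x : GaloisField 2 d | x ^ 6 + x + β = 0}.ncard = 2 ↔
      Algebra.trace (ZMod 2) (GaloisField 2 d) (∑ a ∈ J, β ^ (5 * a)) = 0 := by
  classical
  letI : Fintype (GaloisField 2 d) := Fintype.ofFinite _
  have hc : Fintype.card (GaloisField 2 d) = 2 ^ d := by
    rw [← Nat.card_eq_fintype_card, GaloisField.card 2 d (by omega)]
  have hM0 : 0 < 2 ^ d - 1 := by
    have h8 : 2 ^ 3 ≤ 2 ^ d := Nat.pow_le_pow_right (by norm_num) hd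
    omega
  have hMo : Odd (2 ^ d - 1) := by
    have : 2 ∣ 2 ^ d := dvd_pow_self 2 (by omega)
    rw [Nat.odd_iff]; omega
  have hset : {x : GaloisField 2 d | x ^ 6 + x + β = 0} =
      ↑(Finset.univ.filter (fun x : GaloisField 2 d => segre x = β)) := by
    ext x
    rw [Finset.mem_coe, Finset.mem_filter]
    simp only [Set.mem_ofPred_eq, Finset.mem_univ, true_and, segre]
    rw [CharTwo.add_eq_zero]
  rw [hset, Set.ncard_coe_finset]
  have hiff : (Finset.univ.filter (fun x : GaloisField 2 d => segre x = β)).card = 2 ↔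
      β ∈ Finset.univ.image (segre (F := GaloisField 2 d)) := by
    constructor
    · intro h
      have : (Finset.univ.filter (fun x : GaloisField 2 d => segre x = β)).Nonempty := by
        rw [← Finset.card_pos]; omega
      obtain ⟨x, hx⟩ := this
      exact Finset.mem_image.mpr ⟨x, by simp, (Finset.mem_filter.mp hx).2⟩
    · exact segre_fiber hodd hc β
  rw [hiff]
  have htr : algebraMap (ZMod 2) (GaloisField 2 d)
      (Algebra.trace (ZMod 2) (GaloisField 2 d) (∑ a ∈ J, β ^ (5 * a))) =
      ∑ a ∈ (Finset.Ico 1 (2 ^ d - 1)).filter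
        (fun a => sBin d a + sBin d (5 * a) = sBin d (6 * a) + 1), β ^ (5 * a) := by
    rw [FiniteField.algebraMap_trace_eq_sum_pow, GaloisField.finrank 2 (by omega)]
    simp only [Nat.card_eq_fintype_card, ZMod.card]
    have e1 : ∀ i ∈ Finset.range d, (∑ a ∈ J, β ^ (5 * a)) ^ 2 ^ i =
        ∑ b ∈ J, β ^ (5 * (2 ^ i * b)) := by
      intro i _
      rw [sum_pow_char_pow 2]
      apply Finset.sum_congr rfl
      intro b _
      rw [← pow_mul]
      congr 1; ring
    rw [Finset.sum_congr rfl e1, Finset.sum_comm, ← Finset.sum_product']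
    have hmem : ∀ p ∈ J ×ˢ Finset.range d, (2 ^ p.2 * p.1) % (2 ^ d - 1) ∈
        (Finset.Ico 1 (2 ^ d - 1)).filter
        (fun a => sBin d a + sBin d (5 * a) = sBin d (6 * a) + 1) := by
      rintro ⟨b, i⟩ hp
      obtain ⟨hb, hi⟩ := Finset.mem_product.mp hp
      obtain ⟨h1, h2, h3⟩ := hJsub b hb
      simp only [Finset.mem_filter, Finset.mem_Ico]
      refine ⟨⟨?_, Nat.mod_lt _ hM0⟩, cond_pow hd b i h3⟩
      rw [Nat.one_le_iff_ne_zero]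
      intro hh
      have h4 := Nat.dvd_of_mod_eq_zero hh
      have h5 : Nat.Coprime (2 ^ d - 1) (2 ^ i) := (Nat.coprime_two_right.mpr hMo).pow_right i
      have := Nat.le_of_dvd h1 (h5.dvd_of_dvd_mul_left h4)
      omega
    refine Finset.sum_bij (fun p _ => (2 ^ p.2 * p.1) % (2 ^ d - 1)) hmem ?_ ?_ ?_
    · rintro p hp q hq hpq
      have hm := hmem p hp
      simp only [Finset.mem_filter, Finset.mem_Ico] at hm
      obtain ⟨r, -, hr⟩ := hrep _ (by omega) hm.1.2 hm.2
      have hp' := Finset.mem_product.mp hp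
      have hq' := Finset.mem_product.mp hq
      rw [hr p ⟨hp'.1, Finset.mem_range.mp hp'.2, Nat.mod_modEq _ _⟩,
        hr q ⟨hq'.1, Finset.mem_range.mp hq'.2, by
          rw [hpq]; exact Nat.mod_modEq _ _⟩]
    · intro a ha
      simp only [Finset.mem_filter, Finset.mem_Ico] at ha
      obtain ⟨r, ⟨h1, h2, h3⟩, -⟩ := hrep a (by omega) ha.1.2 ha.2
      refine ⟨r, Finset.mem_product.mpr ⟨h1, Finset.mem_range.mpr h2⟩, ?_⟩
      have : a % (2 ^ d - 1) = (2 ^ r.2 * r.1) % (2 ^ d - 1) := h3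
      rw [← this, Nat.mod_eq_of_lt ha.1.2]
    · intro p _
      have h1 := FiniteField.pow_card_sub_one_eq_one β hβ
      rw [hc] at h1
      conv_lhs => rw [← Nat.mod_add_div (2 ^ p.2 * p.1) (2 ^ d - 1)]
      rw [mul_add, pow_add, show ∀ k, 5 * ((2 ^ d - 1) * k) = (2 ^ d - 1) * (5 * k) by intro k; ring,
        pow_mul β (2 ^ d - 1), h1, one_pow, mul_one]
  have hind := main_indicator hodd hd hc β hβ
  rw [← htr] at hind
  have hz : (algebraMap (ZMod 2) (GaloisField 2 d)
      (Algebra.trace (ZMod 2) (GaloisField 2 d) (∑ a ∈ J, β ^ (5 * a))) = 0) ↔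
      Algebra.trace (ZMod 2) (GaloisField 2 d) (∑ a ∈ J, β ^ (5 * a)) = 0 :=
    map_eq_zero _
  rw [← hz]
  constructor
  · intro h
    rw [if_pos h] at hind
    linear_combination -hind
  · intro h
    rw [h, add_zero] at hind
    by_contra hcon
    rw [if_neg hcon] at hind
    exact zero_ne_one hind
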